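/- Let p ∈ [1,∞), θ ∈ (d−1, d−1+p), α = θ − d + p, and let a^{ij}(t), 1 ≤ i,j ≤ d, be real measurable functions of t only satisfying δ|ξ|² ≤ Σ_{i,j} a^{ij}(t)ξ^iξ^j ≤ K|ξ|² for all ξ ∈ ℝ^d and all t, with 0 < δ ≤ K. Let 0 < r ≤ a and u ∈ C^∞_loc(Ω). Then there is N = N(θ,p,d,δ,K) such that for every ℓ = 1,…,d: ∫_{𝓠_r(a)} |u_{x^ℓ} − (u_{x^ℓ})_{𝓠_r(a)}|^p dμ ≤ N r^p ∫_{𝓠_r(a)} (|u_{xx}|^p + |u_t|^p) dμ. -/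

import Mathlib

open MeasureTheory Set
open scoped ENNReal BigOperators

noncomputable section

abbrev Esp (d : ℕ) := EuclideanSpace ℝ (Fin d)

/-- The spatial half space `{x : x^1 > 0}`. -/
def halfSp (d : ℕ) [NeZero d] : Set (Esp d) := {x | 0 < x 0}

/-- The space-time half space `Ω = ℝ × ℝ^d_+`. -/
def halfST (d : ℕ) [NeZero d] : Set (ℝ × Esp d) := {z | 0 < z.2 0}

/-- The "slab" ball `𝓑_r(x) = (x^1-r, x^1+r) × B'_r(x')`. -/
def sball (d : ℕ) [NeZero d] (r : ℝ) (x : Esp d) : Set (Esp d) :=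
  {y | |y 0 - x 0| < r ∧ ∑ i ∈ Finset.univ.erase (0 : Fin d), (y i - x i) ^ 2 < r ^ 2}

/-- The parabolic cylinder `𝓠_r(t,x) = (t, t+r²) × 𝓑_r(x)`. -/
def pcyl (d : ℕ) [NeZero d] (r t : ℝ) (x : Esp d) : Set (ℝ × Esp d) :=
  Set.Ioo t (t + r ^ 2) ×ˢ sball d r x

/-- The weighted measure `ν(dx) = (x^1)^α dx` on the half space. -/
def nuW (d : ℕ) [NeZero d] (α : ℝ) : Measure (Esp d) :=
  ((volume : Measure (Esp d)).withDensity fun x => ENNReal.ofReal ((x 0) ^ α)).restrict (halfSp d)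

/-- The weighted measure `μ(dtdx) = (x^1)^α dx dt` on `Ω`. -/
def muW (d : ℕ) [NeZero d] (α : ℝ) : Measure (ℝ × Esp d) :=
  ((volume : Measure (ℝ × Esp d)).withDensity fun z => ENNReal.ofReal ((z.2 0) ^ α)).restrict
    (halfST d)

/-- Real-valued average of `g` over `S` with respect to `μ`. -/
def avgR {γ : Type*} [MeasurableSpace γ] (μ : Measure γ) (S : Set γ) (g : γ → ℝ) : ℝ :=
  (μ S).toReal⁻¹ * ∫ z in S, g z ∂μ

/-- `ℝ≥0∞`-valued average of a (nonnegative) function `g` over `S` with respect to `μ`. -/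
def eavg {γ : Type*} [MeasurableSpace γ] (μ : Measure γ) (S : Set γ) (g : γ → ℝ) : ℝ≥0∞ :=
  (μ S)⁻¹ * ∫⁻ z in S, ENNReal.ofReal (g z) ∂μ

/-- Time derivative `u_t`. -/
def ptime (d : ℕ) (u : ℝ × Esp d → ℝ) (z : ℝ × Esp d) : ℝ :=
  deriv (fun s => u (s, z.2)) z.1

/-- Spatial partial derivative `u_{x^i}`. -/
def psp (d : ℕ) [NeZero d] (i : Fin d) (u : ℝ × Esp d → ℝ) (z : ℝ × Esp d) : ℝ :=
  fderiv ℝ (fun y => u (z.1, y)) z.2 (EuclideanSpace.single i 1)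

/-- Norm of the spatial gradient `|u_x|`. -/
def gradNorm (d : ℕ) (u : ℝ × Esp d → ℝ) (z : ℝ × Esp d) : ℝ :=
  ‖fderiv ℝ (fun y => u (z.1, y)) z.2‖

/-- (Frobenius) norm of the spatial Hessian `|u_{xx}|`. -/
def hessNorm (d : ℕ) [NeZero d] (u : ℝ × Esp d → ℝ) (z : ℝ × Esp d) : ℝ :=
  Real.sqrt (∑ i, ∑ j, psp d i (psp d j u) z ^ 2)

/-- `|u_{xx}(w) - (u_{xx})_S|` where the mean of the Hessian over `S` is taken entrywise
with respect to `μ = muW d α`. -/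
def hessDiff (d : ℕ) [NeZero d] (α : ℝ) (u : ℝ × Esp d → ℝ) (S : Set (ℝ × Esp d))
    (w : ℝ × Esp d) : ℝ :=
  Real.sqrt (∑ i, ∑ j,
    (psp d i (psp d j u) w - avgR (muW d α) S (psp d i (psp d j u))) ^ 2)

/-- Partial derivative for functions of the space variable only. -/
def pspS (d : ℕ) [NeZero d] (i : Fin d) (v : Esp d → ℝ) (x : Esp d) : ℝ :=
  fderiv ℝ v x (EuclideanSpace.single i 1)

/-- Iterated spatial derivative `D^β u` along a list of coordinate directions. -/
def mderiv (d : ℕ) [NeZero d] : List (Fin d) → (ℝ × Esp d → ℝ) → ℝ × Esp d → ℝ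
  | [], u => u
  | i :: l, u => psp d i (mderiv d l u)

/-- Iterated derivative along a list of coordinate directions, spatial functions. -/
def mderivS (d : ℕ) [NeZero d] : List (Fin d) → (Esp d → ℝ) → Esp d → ℝ
  | [], v => v
  | i :: l, v => pspS d i (mderivS d l v)

/-- Uniform ellipticity for coefficients depending on `t` only. -/
def ellipT (d : ℕ) (A : ℝ → Fin d → Fin d → ℝ) (δ K : ℝ) : Prop :=
  ∀ (t : ℝ) (ξ : Fin d → ℝ),
    δ * ∑ i, ξ i ^ 2 ≤ ∑ i, ∑ j, A t i j * ξ i * ξ j ∧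
    ∑ i, ∑ j, A t i j * ξ i * ξ j ≤ K * ∑ i, ξ i ^ 2

/-- Uniform ellipticity for coefficients depending on `(t,x)`. -/
def ellipTX (d : ℕ) (A : ℝ × Esp d → Fin d → Fin d → ℝ) (δ K : ℝ) : Prop :=
  ∀ (z : ℝ × Esp d) (ξ : Fin d → ℝ),
    δ * ∑ i, ξ i ^ 2 ≤ ∑ i, ∑ j, A z i j * ξ i * ξ j ∧
    ∑ i, ∑ j, A z i j * ξ i * ξ j ≤ K * ∑ i, ξ i ^ 2

/-- `u ∈ C^∞_0(S)`: smooth, compactly supported, with support contained in `S`. -/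
def CinfC {E : Type*} [NormedAddCommGroup E] [NormedSpace ℝ E] (u : E → ℝ) (S : Set E) : Prop :=
  ContDiff ℝ (⊤ : ℕ∞) u ∧ HasCompactSupport u ∧ tsupport u ⊆ S

/-- Weighted parabolic maximal function `𝕄g`. -/
def maxFn (d : ℕ) [NeZero d] (α : ℝ) (g : ℝ × Esp d → ℝ) (z : ℝ × Esp d) : ℝ≥0∞ :=
  ⨆ (r : ℝ) (t : ℝ) (x : Esp d)
    (_ : 0 < r ∧ pcyl d r t x ⊆ halfST d ∧ z ∈ pcyl d r t x),
    ENNReal.ofReal (avgR (muW d α) (pcyl d r t x) fun w => |g w|)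

/-- Weighted parabolic sharp function `g^♯`. -/
def sharpFn (d : ℕ) [NeZero d] (α : ℝ) (g : ℝ × Esp d → ℝ) (z : ℝ × Esp d) : ℝ≥0∞ :=
  ⨆ (r : ℝ) (t : ℝ) (x : Esp d)
    (_ : 0 < r ∧ pcyl d r t x ⊆ halfST d ∧ z ∈ pcyl d r t x),
    ENNReal.ofReal (avgR (muW d α) (pcyl d r t x)
      fun w => |g w - avgR (muW d α) (pcyl d r t x) g|)

/-- Sharp function of the spatial Hessian `(u_{xx})^♯`. -/
def sharpHess (d : ℕ) [NeZero d] (α : ℝ) (u : ℝ × Esp d → ℝ) (z : ℝ × Esp d) : ℝ≥0∞ :=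
  ⨆ (r : ℝ) (t : ℝ) (x : Esp d)
    (_ : 0 < r ∧ pcyl d r t x ⊆ halfST d ∧ z ∈ pcyl d r t x),
    ENNReal.ofReal (avgR (muW d α) (pcyl d r t x) (hessDiff d α u (pcyl d r t x)))

/-- Weighted mean oscillation `osc^θ_x(a, 𝓠_r(t,x))` (Frobenius norm of matrix differences). -/
def oscWgt (d : ℕ) [NeZero d] (α : ℝ) (A : ℝ × Esp d → Fin d → Fin d → ℝ)
    (r t : ℝ) (x : Esp d) : ℝ :=
  (r ^ 2)⁻¹ * ∫ s in Set.Ioo t (t + r ^ 2),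
    avgR (nuW d α) (sball d r x) fun y =>
      avgR (nuW d α) (sball d r x) fun z =>
        Real.sqrt (∑ i, ∑ j, (A (s, y) i j - A (s, z) i j) ^ 2)

/-- Unweighted (Lebesgue) mean oscillation `osc_x(a, 𝓠_r(t,x))`. -/
def oscLeb (d : ℕ) [NeZero d] (A : ℝ × Esp d → Fin d → Fin d → ℝ)
    (r t : ℝ) (x : Esp d) : ℝ :=
  (r ^ 2)⁻¹ * ∫ s in Set.Ioo t (t + r ^ 2),
    avgR (volume : Measure (Esp d)) (sball d r x) fun y =>
      avgR (volume : Measure (Esp d)) (sball d r x) fun z =>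
        Real.sqrt (∑ i, ∑ j, (A (s, y) i j - A (s, z) i j) ^ 2)

/-- `𝓠_r(t,x) ∈ 𝔹(R,κ)`. -/
def inBQ (d : ℕ) [NeZero d] (R κ r t : ℝ) (x : Esp d) : Prop :=
  0 < x 0 ∧ 0 < r ∧ r ≤ κ * x 0 ∧ x 0 + r ≤ R

/-- `a^{#(θ)}_{R,κ}`, the supremum of weighted oscillations over `𝔹(R,κ)`. -/
def aSharp (d : ℕ) [NeZero d] (α R κ : ℝ) (A : ℝ × Esp d → Fin d → Fin d → ℝ) : ℝ :=
  sSup {v : ℝ | ∃ r t x, inBQ d R κ r t x ∧ v = oscWgt d α A r t x}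

/-- `a^{#(θ)}_κ = sup_{R>0} a^{#(θ)}_{R,κ}`. -/
def aSharpFull (d : ℕ) [NeZero d] (α κ : ℝ) (A : ℝ × Esp d → Fin d → Fin d → ℝ) : ℝ :=
  sSup {v : ℝ | ∃ (r t : ℝ) (x : Esp d), 0 < x 0 ∧ 0 < r ∧ r ≤ κ * x 0 ∧
    v = oscWgt d α A r t x}

/-- The weighted Sobolev-type norm `⟦v⟧^p = Σ_{|β| ≤ n} ∫ ((x^1)^{|β|}|D^β v|)^p (x^1)^{θ-d} dx`,
where mixed partial derivatives are enumerated by ordered tuples of directions. -/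
def wnorm (d : ℕ) [NeZero d] (p θ : ℝ) (n : ℕ) (v : Esp d → ℝ) : ℝ :=
  ∑ k ∈ Finset.range (n + 1), ∑ σ : Fin k → Fin d,
    ∫ x in halfSp d, ((x 0) ^ (k : ℝ) * |mderivS d (List.ofFn σ) v x|) ^ p * (x 0) ^ (θ - d)

/-- The cylinder `𝓠_r(a) = 𝓠_r(0,(a,0))`. -/
def cylA (d : ℕ) [NeZero d] (r aa : ℝ) : Set (ℝ × Esp d) :=
  pcyl d r 0 (EuclideanSpace.single (0 : Fin d) aa)

/-- Jensen's inequality for the power function and a finite measure, in `ℝ≥0∞`. -/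
theorem lintegral_rpow_le_measure_univ_rpow_mul {X : Type*} [MeasurableSpace X] {ν : Measure X}
    {p : ℝ} (hp : 1 ≤ p) {f : X → ℝ≥0∞} (hf : AEMeasurable f ν) :
    (∫⁻ x, f x ∂ν) ^ p ≤ ν univ ^ (p - 1) * ∫⁻ x, f x ^ p ∂ν := by
  have hp0 : 0 < p := by linarith
  have h := eLpNorm'_le_eLpNorm'_mul_rpow_measure_univ (f := f) one_pos hp
    hf.aestronglyMeasurable
  simp only [eLpNorm', enorm_eq_self, ENNReal.rpow_one, div_one] at h
  calc (∫⁻ x, f x ∂ν) ^ p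
      ≤ ((∫⁻ x, f x ^ p ∂ν) ^ (1 / p) * ν univ ^ (1 - 1 / p)) ^ p := by gcongr
    _ = ν univ ^ (p - 1) * ∫⁻ x, f x ^ p ∂ν := by
      rw [ENNReal.mul_rpow_of_nonneg _ _ hp0.le, ← ENNReal.rpow_mul, ← ENNReal.rpow_mul,
        one_div_mul_cancel hp0.ne', ENNReal.rpow_one, mul_comm]
      congr 2
      field_simp

/-- The deviation of a constant from a mean is controlled by the mean deviation. No integrability
of `v` is needed: if `v` is not integrable then the right-hand side is infinite. -/
theorem enorm_sub_average_rpow_le {X : Type*} [MeasurableSpace X] {ν : Measure X}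
    [IsFiniteMeasure ν] (hν : ν univ ≠ 0) {p : ℝ} (hp : 1 ≤ p) {v : X → ℝ} (hv : Measurable v)
    (c : ℝ) :
    ‖c - (ν univ).toReal⁻¹ * ∫ y, v y ∂ν‖ₑ ^ p ≤ (ν univ)⁻¹ * ∫⁻ y, ‖c - v y‖ₑ ^ p ∂ν := by
  have hp0 : 0 < p := by linarith
  have hfin : ν univ ≠ ∞ := measure_ne_top _ _
  have hJ := lintegral_rpow_le_measure_univ_rpow_mul (ν := ν) hp (f := fun y => ‖c - v y‖ₑ)
    (by fun_prop)
  by_cases htop : ∫⁻ y, ‖c - v y‖ₑ ^ p ∂ν = ∞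
  · rw [htop, ENNReal.mul_top (ENNReal.inv_ne_zero.2 hfin)]
    exact le_top
  have h1 : ∫⁻ y, ‖c - v y‖ₑ ∂ν ≠ ∞ := by
    intro h
    rw [h, ENNReal.top_rpow_of_pos hp0, top_le_iff] at hJ
    exact ENNReal.mul_ne_top (ENNReal.rpow_ne_top_of_nonneg (by linarith) hfin) htop hJ
  have hint : Integrable (fun y => c - v y) ν := ⟨by fun_prop, h1.lt_top⟩
  have hvint : Integrable v ν := by
    have := (integrable_const c).sub hint
    refine this.congr (Filter.Eventually.of_forall fun y => ?_)
    simp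
  have hr : (ν univ).toReal ≠ 0 := (ENNReal.toReal_pos hν hfin).ne'
  have heq : c - (ν univ).toReal⁻¹ * ∫ y, v y ∂ν
      = (ν univ).toReal⁻¹ * ∫ y, (c - v y) ∂ν := by
    rw [integral_sub (integrable_const c) hvint, integral_const, smul_eq_mul, Measure.real]
    field_simp
  have hinv : ‖(ν univ).toReal⁻¹‖ₑ = (ν univ)⁻¹ := by
    rw [← ENNReal.toReal_inv, Real.enorm_eq_ofReal ENNReal.toReal_nonneg,
      ENNReal.ofReal_toReal (ENNReal.inv_ne_top.2 hν)]
  rw [heq, enorm_mul, hinv, ENNReal.mul_rpow_of_nonneg _ _ hp0.le]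
  calc (ν univ)⁻¹ ^ p * ‖∫ y, (c - v y) ∂ν‖ₑ ^ p
      ≤ (ν univ)⁻¹ ^ p * (∫⁻ y, ‖c - v y‖ₑ ∂ν) ^ p := by
        gcongr; exact enorm_integral_le_lintegral_enorm _
    _ ≤ (ν univ)⁻¹ ^ p * (ν univ ^ (p - 1) * ∫⁻ y, ‖c - v y‖ₑ ^ p ∂ν) := by gcongr
    _ = (ν univ)⁻¹ * ∫⁻ y, ‖c - v y‖ₑ ^ p ∂ν := by
      rw [← mul_assoc]
      congr 1
      rw [ENNReal.inv_rpow, ← ENNReal.rpow_neg, ← ENNReal.rpow_add _ _ hν hfin,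
        ← ENNReal.rpow_neg_one]
      congr 1
      ring

theorem add_four_rpow_le (a b c e : ℝ≥0∞) {p : ℝ} (hp : 1 ≤ p) :
    (a + b + c + e) ^ p ≤ 4 ^ p * (a ^ p + b ^ p + c ^ p + e ^ p) := by
  have h2 : ∀ x y : ℝ≥0∞, (x + y) ^ p ≤ 2 ^ p * (x ^ p + y ^ p) := fun x y =>
    (ENNReal.rpow_add_le_mul_rpow_add_rpow x y hp).trans (by
      gcongr
      · exact one_le_two
      · linarith)
  calc (a + b + c + e) ^ p = ((a + b) + (c + e)) ^ p := by rw [add_assoc (a + b)]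
    _ ≤ 2 ^ p * (2 ^ p * (a ^ p + b ^ p) + 2 ^ p * (c ^ p + e ^ p)) :=
      (h2 _ _).trans (by gcongr <;> exact h2 _ _)
    _ = (2 * 2) ^ p * (a ^ p + b ^ p + c ^ p + e ^ p) := by
      rw [ENNReal.mul_rpow_of_nonneg _ _ (by linarith)]; ring
    _ = 4 ^ p * (a ^ p + b ^ p + c ^ p + e ^ p) := by norm_num

/-- The double `L^p` oscillation of `v` over a product space is controlled by its oscillation in
the second variable, its distance to a comparison function `D`, and the oscillation of `D` in the
first variable. -/
theorem lintegral_lintegral_enorm_sub_rpow_le {X Y : Type*} [MeasurableSpace X]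
    [MeasurableSpace Y] {κ : Measure X} {ν : Measure Y} [IsFiniteMeasure κ] [IsFiniteMeasure ν]
    {p : ℝ} (hp : 1 ≤ p) {v D : X × Y → ℝ} (hv : Measurable v) (hD : Measurable D)
    {H : X → ℝ≥0∞} {T : ℝ≥0∞}
    (hosc : ∀ᵐ t ∂κ, ∫⁻ x, ∫⁻ y, ‖v (t, x) - v (t, y)‖ₑ ^ p ∂ν ∂ν ≤ ν univ * H t)
    (hdist : ∀ᵐ t ∂κ, ∫⁻ y, ‖v (t, y) - D (t, y)‖ₑ ^ p ∂ν ≤ H t)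
    (htime : ∀ᵐ t ∂κ, ∀ᵐ s ∂κ, ∫⁻ y, ‖D (t, y) - D (s, y)‖ₑ ^ p ∂ν ≤ T) :
    ∫⁻ z, ∫⁻ z', ‖v z - v z'‖ₑ ^ p ∂(κ.prod ν) ∂(κ.prod ν) ≤
      4 ^ p * (κ univ * ν univ) * (3 * ∫⁻ t, H t ∂κ + κ univ * T) := by
  have hκ : κ univ ≠ ∞ := measure_ne_top _ _
  have hν : ν univ ≠ ∞ := measure_ne_top _ _
  have hsplit : ∀ F : X → Y → X → Y → ℝ≥0∞,
      Measurable (fun w : (X × Y) × (X × Y) => F w.1.1 w.1.2 w.2.1 w.2.2) →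
      ∫⁻ w, F w.1.1 w.1.2 w.2.1 w.2.2 ∂((κ.prod ν).prod (κ.prod ν)) =
        ∫⁻ t, ∫⁻ x, ∫⁻ s, ∫⁻ y, F t x s y ∂ν ∂κ ∂ν ∂κ := by
    intro F hF
    rw [lintegral_prod _ hF.aemeasurable, lintegral_prod _ hF.lintegral_prod_right'.aemeasurable]
    refine lintegral_congr fun t => lintegral_congr fun x => ?_
    exact lintegral_prod _ (hF.comp measurable_prodMk_left).aemeasurable
  have h1 : ∫⁻ w, ‖v (w.1.1, w.1.2) - v (w.1.1, w.2.2)‖ₑ ^ p ∂((κ.prod ν).prod (κ.prod ν)) ≤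
      κ univ * ν univ * ∫⁻ t, H t ∂κ := by
    rw [hsplit (fun t x _ y => ‖v (t, x) - v (t, y)‖ₑ ^ p) (by fun_prop)]
    calc ∫⁻ t, ∫⁻ x, ∫⁻ _, ∫⁻ y, ‖v (t, x) - v (t, y)‖ₑ ^ p ∂ν ∂κ ∂ν ∂κ
        = ∫⁻ t, (∫⁻ x, ∫⁻ y, ‖v (t, x) - v (t, y)‖ₑ ^ p ∂ν ∂ν) * κ univ ∂κ := by
          simp_rw [lintegral_const, lintegral_mul_const' _ _ hκ]
      _ ≤ ∫⁻ t, ν univ * H t * κ univ ∂κ :=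
          lintegral_mono_ae (hosc.mono fun t ht => by gcongr)
      _ = κ univ * ν univ * ∫⁻ t, H t ∂κ := by
          rw [lintegral_mul_const' _ _ hκ, lintegral_const_mul' _ _ hν]; ring
  have h2 : ∫⁻ w, ‖v (w.1.1, w.2.2) - D (w.1.1, w.2.2)‖ₑ ^ p ∂((κ.prod ν).prod (κ.prod ν)) ≤
      κ univ * ν univ * ∫⁻ t, H t ∂κ := by
    rw [hsplit (fun t _ _ y => ‖v (t, y) - D (t, y)‖ₑ ^ p) (by fun_prop)]
    simp_rw [lintegral_const, lintegral_mul_const' _ _ hν, lintegral_mul_const' _ _ hκ]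
    calc (∫⁻ t, ∫⁻ y, ‖v (t, y) - D (t, y)‖ₑ ^ p ∂ν ∂κ) * κ univ * ν univ
        ≤ (∫⁻ t, H t ∂κ) * κ univ * ν univ := by
          gcongr ?_ * _ * _
          exact lintegral_mono_ae hdist
      _ = κ univ * ν univ * ∫⁻ t, H t ∂κ := by ring
  have h3 : ∫⁻ w, ‖D (w.1.1, w.2.2) - D (w.2.1, w.2.2)‖ₑ ^ p ∂((κ.prod ν).prod (κ.prod ν)) ≤
      κ univ * ν univ * (κ univ * T) := by
    rw [hsplit (fun t _ s y => ‖D (t, y) - D (s, y)‖ₑ ^ p) (by fun_prop)]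
    simp_rw [lintegral_const, lintegral_mul_const' _ _ hν]
    calc (∫⁻ t, ∫⁻ s, ∫⁻ y, ‖D (t, y) - D (s, y)‖ₑ ^ p ∂ν ∂κ ∂κ) * ν univ
        ≤ (∫⁻ _, ∫⁻ _, T ∂κ ∂κ) * ν univ := by
          gcongr ?_ * _
          exact lintegral_mono_ae (htime.mono fun t ht => lintegral_mono_ae ht)
      _ = κ univ * ν univ * (κ univ * T) := by
          simp_rw [lintegral_const]; ring
  have h4 : ∫⁻ w, ‖D (w.2.1, w.2.2) - v (w.2.1, w.2.2)‖ₑ ^ p ∂((κ.prod ν).prod (κ.prod ν)) ≤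
      κ univ * ν univ * ∫⁻ t, H t ∂κ := by
    rw [hsplit (fun _ _ s y => ‖D (s, y) - v (s, y)‖ₑ ^ p) (by fun_prop)]
    rw [lintegral_const, lintegral_const]
    calc (∫⁻ s, ∫⁻ y, ‖D (s, y) - v (s, y)‖ₑ ^ p ∂ν ∂κ) * ν univ * κ univ
        ≤ (∫⁻ t, H t ∂κ) * ν univ * κ univ := by
          gcongr ?_ * _ * _
          refine lintegral_mono_ae (hdist.mono fun t ht => ?_)
          simpa only [enorm_sub_rev] using ht
      _ = κ univ * ν univ * ∫⁻ t, H t ∂κ := by ring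
  calc ∫⁻ z, ∫⁻ z', ‖v z - v z'‖ₑ ^ p ∂(κ.prod ν) ∂(κ.prod ν)
      = ∫⁻ w, ‖v w.1 - v w.2‖ₑ ^ p ∂((κ.prod ν).prod (κ.prod ν)) :=
        (lintegral_prod (fun w : (X × Y) × (X × Y) => ‖v w.1 - v w.2‖ₑ ^ p)
          (by fun_prop)).symm
    _ ≤ ∫⁻ w, 4 ^ p * (‖v (w.1.1, w.1.2) - v (w.1.1, w.2.2)‖ₑ ^ p
          + ‖v (w.1.1, w.2.2) - D (w.1.1, w.2.2)‖ₑ ^ p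
          + ‖D (w.1.1, w.2.2) - D (w.2.1, w.2.2)‖ₑ ^ p
          + ‖D (w.2.1, w.2.2) - v (w.2.1, w.2.2)‖ₑ ^ p) ∂((κ.prod ν).prod (κ.prod ν)) := by
        refine lintegral_mono fun w => le_trans ?_ (add_four_rpow_le _ _ _ _ hp)
        gcongr
        refine le_trans (le_of_eq ?_) ((enorm_add_le _ _).trans (add_le_add_left
          ((enorm_add_le _ _).trans (add_le_add_left (enorm_add_le _ _) _)) _))
        congr 1
        ring
    _ ≤ 4 ^ p * (κ univ * ν univ * ∫⁻ t, H t ∂κ + κ univ * ν univ * ∫⁻ t, H t ∂κ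
          + κ univ * ν univ * (κ univ * T) + κ univ * ν univ * ∫⁻ t, H t ∂κ) := by
        rw [lintegral_const_mul _ (by fun_prop), lintegral_add_right _ (by fun_prop),
          lintegral_add_right _ (by fun_prop), lintegral_add_right _ (by fun_prop)]
        gcongr
    _ = 4 ^ p * (κ univ * ν univ) * (3 * ∫⁻ t, H t ∂κ + κ univ * T) := by ring

theorem isOpen_halfST (d : ℕ) [NeZero d] : IsOpen (halfST d) :=
  isOpen_lt continuous_const (by fun_prop)

theorem isOpen_sball (d : ℕ) [NeZero d] (r : ℝ) (x : Esp d) : IsOpen (sball d r x) :=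
  (isOpen_lt (f := fun y : Esp d => |y 0 - x 0|) (by fun_prop) continuous_const).inter
    (isOpen_lt (f := fun y : Esp d => ∑ i ∈ Finset.univ.erase (0 : Fin d), (y i - x i) ^ 2)
      (by fun_prop) continuous_const)

theorem convex_sball (d : ℕ) [NeZero d] (r : ℝ) (x : Esp d) : Convex ℝ (sball d r x) := by
  have hsq : ∀ a b u v : ℝ, 0 ≤ a → 0 ≤ b → a + b = 1 →
      (a * u + b * v) ^ 2 ≤ a * u ^ 2 + b * v ^ 2 := by
    intro a b u v ha hb hab
    obtain rfl : b = 1 - a := by linarith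
    nlinarith [mul_nonneg (mul_nonneg ha hb) (sq_nonneg (u - v))]
  intro y hy z hz a b ha hb hab
  have hcoord : ∀ i, (a • y + b • z) i - x i = a * (y i - x i) + b * (z i - x i) := by
    intro i
    simp only [PiLp.add_apply, PiLp.smul_apply, smul_eq_mul]
    linear_combination x i * hab
  constructor
  · have h := convex_ball (0 : ℝ) r (x := y 0 - x 0) (y := z 0 - x 0)
      (by simpa using hy.1) (by simpa using hz.1) ha hb hab
    simp only [mem_ball_zero_iff, Real.norm_eq_abs, smul_eq_mul] at h
    rw [hcoord]
    exact h
  · have h := convex_Iio (r ^ 2) hy.2 hz.2 ha hb hab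
    refine lt_of_le_of_lt ?_ h
    simp only [smul_eq_mul, Finset.mul_sum, ← Finset.sum_add_distrib]
    refine Finset.sum_le_sum fun i _ => ?_
    rw [hcoord]
    exact hsq _ _ _ _ ha hb hab

theorem norm_sub_le_of_mem_sball {d : ℕ} [NeZero d] {r : ℝ} (hr : 0 < r) {x y z : Esp d}
    (hy : y ∈ sball d r x) (hz : z ∈ sball d r x) : ‖y - z‖ ≤ 4 * r := by
  have h0 : (y 0 - z 0) ^ 2 ≤ 4 * r ^ 2 := by
    have h1 := abs_lt.1 hy.1
    have h2 := abs_lt.1 hz.1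
    nlinarith
  have h1 : ∑ i ∈ Finset.univ.erase (0 : Fin d), (y i - z i) ^ 2 ≤ 2 * r ^ 2 + 2 * r ^ 2 := by
    calc ∑ i ∈ Finset.univ.erase (0 : Fin d), (y i - z i) ^ 2
        ≤ ∑ i ∈ Finset.univ.erase (0 : Fin d), (2 * (y i - x i) ^ 2 + 2 * (z i - x i) ^ 2) :=
          Finset.sum_le_sum fun i _ => by nlinarith [sq_nonneg (y i - x i + (z i - x i))]
      _ ≤ 2 * r ^ 2 + 2 * r ^ 2 := by
          rw [Finset.sum_add_distrib, ← Finset.mul_sum, ← Finset.mul_sum]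
          have := hy.2
          have := hz.2
          gcongr
  rw [EuclideanSpace.norm_eq]
  refine Real.sqrt_le_iff.2 ⟨by positivity, ?_⟩
  simp only [PiLp.sub_apply, Real.norm_eq_abs, sq_abs]
  rw [← Finset.add_sum_erase _ _ (Finset.mem_univ (0 : Fin d))]
  nlinarith [sq_nonneg r]

theorem isBounded_sball {d : ℕ} [NeZero d] {r : ℝ} (hr : 0 < r) (x : Esp d) :
    Bornology.IsBounded (sball d r x) :=
  Metric.isBounded_iff.2 ⟨4 * r, fun _ hy _ hz => by
    rw [dist_eq_norm]; exact norm_sub_le_of_mem_sball hr hy hz⟩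

theorem pos_of_mem_sball {d : ℕ} [NeZero d] {r aa : ℝ} (hra : r ≤ aa) {y : Esp d}
    (hy : y ∈ sball d r (EuclideanSpace.single (0 : Fin d) aa)) : 0 < y 0 := by
  have h := abs_lt.1 hy.1
  simp only [PiLp.single_apply, if_true] at h
  linarith

theorem add_smul_single_mem_sball {d : ℕ} [NeZero d] {r : ℝ} {x : Esp d} {τ : ℝ}
    (hτ : |τ| < r) (ℓ : Fin d) : x + τ • EuclideanSpace.single ℓ (1 : ℝ) ∈ sball d r x := by
  have hr : 0 < r := (abs_nonneg τ).trans_lt hτ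
  have hsq : τ ^ 2 < r ^ 2 := by rw [← sq_abs]; gcongr
  constructor
  · by_cases h : (0 : Fin d) = ℓ
    · simpa [h] using hτ
    · simpa [h] using hr
  · simp only [PiLp.add_apply, PiLp.smul_apply, PiLp.single_apply, smul_eq_mul,
      add_sub_cancel_left]
    refine lt_of_le_of_lt ?_ hsq
    calc ∑ i ∈ Finset.univ.erase (0 : Fin d), (τ * if i = ℓ then (1 : ℝ) else 0) ^ 2
        ≤ ∑ i, (τ * if i = ℓ then (1 : ℝ) else 0) ^ 2 :=
          Finset.sum_le_sum_of_subset_of_nonneg (Finset.erase_subset _ _)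
            fun i _ _ => sq_nonneg _
      _ ≤ τ ^ 2 := by simp [ite_pow]

/-- The measure `(x^1)^α dx` restricted to the slab ball around `(aa, 0)`. -/
def slabMeasure (d : ℕ) [NeZero d] (α r aa : ℝ) : Measure (Esp d) :=
  ((volume : Measure (Esp d)).restrict
    (sball d r (EuclideanSpace.single (0 : Fin d) aa))).withDensity
      fun x => ENNReal.ofReal ((x 0) ^ α)

theorem measurable_weight (d : ℕ) [NeZero d] (α : ℝ) :
    Measurable fun x : Esp d => ENNReal.ofReal ((x 0) ^ α) := by
  fun_prop

theorem muW_restrict_cylA {d : ℕ} [NeZero d] {α r aa : ℝ} (hra : r ≤ aa) :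
    (muW d α).restrict (cylA d r aa) =
      ((volume : Measure ℝ).restrict (Ioo 0 (r ^ 2))).prod (slabMeasure d α r aa) := by
  have hsub : cylA d r aa ⊆ halfST d := fun z hz => pos_of_mem_sball hra hz.2
  have hmeas : MeasurableSet (cylA d r aa) := measurableSet_Ioo.prod (isOpen_sball _ _ _).measurableSet
  rw [muW, Measure.restrict_restrict hmeas, inter_eq_left.2 hsub, slabMeasure,
    prod_withDensity_right (measurable_weight d α), restrict_withDensity hmeas,
    Measure.prod_restrict, cylA, pcyl, zero_add]
  rfl

theorem ae_mem_sball (d : ℕ) [NeZero d] (α r aa : ℝ) :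
    ∀ᵐ x ∂slabMeasure d α r aa, x ∈ sball d r (EuclideanSpace.single (0 : Fin d) aa) :=
  (withDensity_absolutelyContinuous _ _).ae_le
    (ae_restrict_mem (isOpen_sball _ _ _).measurableSet)

theorem isFiniteMeasure_slabMeasure {d : ℕ} [NeZero d] {α r aa : ℝ} (hα : 0 ≤ α) (hr : 0 < r)
    (hra : r ≤ aa) : IsFiniteMeasure (slabMeasure d α r aa) := by
  have hB := (isOpen_sball d r (EuclideanSpace.single (0 : Fin d) aa)).measurableSet
  refine isFiniteMeasure_withDensity (ne_top_of_le_ne_top ?_ (setLIntegral_mono'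
    (g := fun _ => ENNReal.ofReal ((aa + r) ^ α)) hB fun x hx => ?_))
  · rw [setLIntegral_const]
    exact ENNReal.mul_ne_top ENNReal.ofReal_ne_top (isBounded_sball hr _).measure_lt_top.ne
  · have h0 := (pos_of_mem_sball hra hx).le
    have h := abs_lt.1 hx.1
    simp only [PiLp.single_apply, if_true] at h
    gcongr
    linarith

theorem slabMeasure_univ_ne_zero {d : ℕ} [NeZero d] {α r aa : ℝ} (hr : 0 < r)
    (hra : r ≤ aa) : slabMeasure d α r aa univ ≠ 0 := by
  set b : Esp d := EuclideanSpace.single (0 : Fin d) aa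
  have hb : b ∈ sball d r b := by
    simpa using add_smul_single_mem_sball (x := b) (τ := 0) (by simpa using hr) (0 : Fin d)
  have hB := isOpen_sball d r b
  rw [slabMeasure, withDensity_apply _ MeasurableSet.univ, Measure.restrict_univ]
  refine (setLIntegral_pos_iff (measurable_weight d α)).2 ?_ |>.ne'
  refine (hB.measure_pos volume ⟨b, hb⟩).trans_le (measure_mono fun x hx => ⟨?_, hx⟩)
  simpa using Real.rpow_pos_of_pos (pos_of_mem_sball hra hx) α

/-- Contractions towards a point of the slab ball by a factor at least `1/2` push the weighted
measure forward to a measure dominated by a multiple of itself. -/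
theorem lintegral_comp_contraction_le {d : ℕ} [NeZero d] {α r aa : ℝ} (hα : 0 ≤ α)
    (hra : r ≤ aa) {g : Esp d → ℝ≥0∞} (hg : Measurable g) {τ : ℝ} (hτ : 1 / 2 ≤ τ) (hτ1 : τ ≤ 1)
    {c : Esp d} (hc : c ∈ sball d r (EuclideanSpace.single (0 : Fin d) aa)) :
    ∫⁻ x, g (τ • x + (1 - τ) • c) ∂slabMeasure d α r aa ≤
      ENNReal.ofReal (2 ^ α * 2 ^ d) * ∫⁻ x, g x ∂slabMeasure d α r aa := by
  set B := sball d r (EuclideanSpace.single (0 : Fin d) aa) with hBdef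
  have hB : MeasurableSet B := (isOpen_sball _ _ _).measurableSet
  have hτ0 : 0 < τ := by linarith
  have hwm := measurable_weight d α
  set w : Esp d → ℝ≥0∞ := fun x => ENNReal.ofReal ((x 0) ^ α) with hw
  have hrw : ∀ f : Esp d → ℝ≥0∞, Measurable f →
      ∫⁻ x, f x ∂slabMeasure d α r aa = ∫⁻ x, B.indicator (fun x => w x * f x) x := by
    intro f hf
    rw [slabMeasure, lintegral_withDensity_eq_lintegral_mul _ hwm hf, lintegral_indicator hB]
    rfl
  have hscale : ∀ f : Esp d → ℝ≥0∞, Measurable f →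
      ∫⁻ x, f (τ • x + (1 - τ) • c) ≤ ENNReal.ofReal (2 ^ d) * ∫⁻ x, f x := by
    intro f hf
    have h1 : ∫⁻ x, f (τ • x + (1 - τ) • c)
        = ∫⁻ y, f (y + (1 - τ) • c) ∂(Measure.map (τ • ·) (volume : Measure (Esp d))) :=
      (lintegral_map (f := fun y => f (y + (1 - τ) • c)) (by fun_prop) (by fun_prop)).symm
    rw [h1, Measure.map_addHaar_smul _ hτ0.ne', lintegral_smul_measure, smul_eq_mul,
      lintegral_add_right_eq_self, finrank_euclideanSpace_fin]
    gcongr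
    rw [abs_of_pos (by positivity), ← inv_pow]
    gcongr
    rw [inv_le_comm₀ hτ0 two_pos]
    linarith
  rw [hrw _ (by fun_prop), hrw _ hg]
  calc ∫⁻ x, B.indicator (fun x => w x * g (τ • x + (1 - τ) • c)) x
      ≤ ∫⁻ x, ENNReal.ofReal (2 ^ α) * B.indicator (fun x => w x * g x) (τ • x + (1 - τ) • c) := by
        refine lintegral_mono fun x => ?_
        by_cases hx : x ∈ B
        · have hmem : τ • x + (1 - τ) • c ∈ B :=
            convex_sball _ _ _ hx hc hτ0.le (by linarith) (by ring)
          rw [indicator_of_mem hx, indicator_of_mem hmem, ← mul_assoc]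
          gcongr
          have hx0 := pos_of_mem_sball hra hx
          have hc0 := pos_of_mem_sball hra hc
          rw [hw, ← ENNReal.ofReal_mul (by positivity)]
          refine ENNReal.ofReal_le_ofReal ?_
          have hm0 := pos_of_mem_sball hra hmem
          rw [← Real.mul_rpow two_pos.le hm0.le]
          gcongr
          simp only [PiLp.add_apply, PiLp.smul_apply, smul_eq_mul]
          nlinarith [mul_nonneg (sub_nonneg.2 hτ1) hc0.le]
        · rw [indicator_of_notMem hx]
          exact zero_le
    _ = ENNReal.ofReal (2 ^ α) * ∫⁻ x, B.indicator (fun x => w x * g x) (τ • x + (1 - τ) • c) :=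
        lintegral_const_mul' _ _ ENNReal.ofReal_ne_top
    _ ≤ ENNReal.ofReal (2 ^ α) *
          (ENNReal.ofReal (2 ^ d) * ∫⁻ x, B.indicator (fun x => w x * g x) x) := by
        gcongr
        exact hscale _ ((hwm.mul hg).indicator hB)
    _ = _ := by rw [← mul_assoc, ← ENNReal.ofReal_mul (by positivity)]

section Slices

variable {d : ℕ} [NeZero d] {α r aa p : ℝ} {f : Esp d → ℝ} {G : Esp d → ℝ≥0∞} {L : ℝ≥0∞}

theorem enorm_sub_rpow_le_lintegral_segment (hp : 1 ≤ p) (hG : Measurable G)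
    (hseg : ∀ x ∈ sball d r (EuclideanSpace.single (0 : Fin d) aa),
      ∀ y ∈ sball d r (EuclideanSpace.single (0 : Fin d) aa),
        ‖f x - f y‖ₑ ≤ L * ∫⁻ τ in Icc (0 : ℝ) 1, G (τ • x + (1 - τ) • y))
    {x y : Esp d} (hx : x ∈ sball d r (EuclideanSpace.single (0 : Fin d) aa))
    (hy : y ∈ sball d r (EuclideanSpace.single (0 : Fin d) aa)) :
    ‖f x - f y‖ₑ ^ p ≤ L ^ p * ∫⁻ τ in Icc (0 : ℝ) 1, G (τ • x + (1 - τ) • y) ^ p := by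
  have hJ := lintegral_rpow_le_measure_univ_rpow_mul (ν := volume.restrict (Icc (0 : ℝ) 1)) hp
    (f := fun τ => G (τ • x + (1 - τ) • y)) (by fun_prop)
  simp only [Measure.restrict_apply_univ, Real.volume_Icc, sub_zero, ENNReal.ofReal_one,
    ENNReal.one_rpow, one_mul] at hJ
  calc ‖f x - f y‖ₑ ^ p
      ≤ (L * ∫⁻ τ in Icc (0 : ℝ) 1, G (τ • x + (1 - τ) • y)) ^ p := by
        gcongr; exact hseg x hx y hy
    _ ≤ _ := by
        rw [ENNReal.mul_rpow_of_nonneg _ _ (by linarith)]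
        gcongr

/-- Weighted Poincaré inequality on a slab ball, in double-integral form. -/
theorem lintegral_lintegral_enorm_sub_rpow_le_slab (hα : 0 ≤ α) (hr : 0 < r) (hra : r ≤ aa)
    (hp : 1 ≤ p) (hG : Measurable G) (hL : L ≠ ∞)
    (hseg : ∀ x ∈ sball d r (EuclideanSpace.single (0 : Fin d) aa),
      ∀ y ∈ sball d r (EuclideanSpace.single (0 : Fin d) aa),
        ‖f x - f y‖ₑ ≤ L * ∫⁻ τ in Icc (0 : ℝ) 1, G (τ • x + (1 - τ) • y)) :
    ∫⁻ x, ∫⁻ y, ‖f x - f y‖ₑ ^ p ∂slabMeasure d α r aa ∂slabMeasure d α r aa ≤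
      slabMeasure d α r aa univ *
        (L ^ p * (ENNReal.ofReal (2 ^ α * 2 ^ d) * ∫⁻ x, G x ^ p ∂slabMeasure d α r aa)) := by
  have hfin := isFiniteMeasure_slabMeasure (d := d) hα hr hra
  set ν := slabMeasure d α r aa with hν
  have hLp : L ^ p ≠ ∞ := ENNReal.rpow_ne_top_of_nonneg (by linarith) hL
  set M := ENNReal.ofReal (2 ^ α * 2 ^ d) * ∫⁻ x, G x ^ p ∂ν with hM
  have hmem := ae_mem_sball d α r aa
  have hτ : ∀ τ ∈ Icc (0 : ℝ) 1, ∫⁻ x, ∫⁻ y, G (τ • x + (1 - τ) • y) ^ p ∂ν ∂ν ≤ M * ν univ := by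
    intro τ hτ
    rcases le_total (1 / 2) τ with h | h
    · rw [lintegral_lintegral_swap (by fun_prop), ← lintegral_const]
      refine lintegral_mono_ae (hmem.mono fun y hy => ?_)
      exact lintegral_comp_contraction_le hα hra (hG.pow_const p) h hτ.2 hy
    · rw [← lintegral_const]
      refine lintegral_mono_ae (hmem.mono fun x hx => ?_)
      have := lintegral_comp_contraction_le hα hra (hG.pow_const p) (τ := 1 - τ)
        (by linarith) (by linarith [hτ.1]) hx
      simpa only [sub_sub_cancel, add_comm] using this
  calc ∫⁻ x, ∫⁻ y, ‖f x - f y‖ₑ ^ p ∂ν ∂ν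
      ≤ ∫⁻ x, ∫⁻ y, L ^ p * (∫⁻ τ in Icc (0 : ℝ) 1, G (τ • x + (1 - τ) • y) ^ p) ∂ν ∂ν :=
        lintegral_mono_ae (hmem.mono fun x hx => lintegral_mono_ae (hmem.mono fun y hy =>
          enorm_sub_rpow_le_lintegral_segment hp hG hseg hx hy))
    _ = L ^ p * ∫⁻ x, (∫⁻ τ in Icc (0 : ℝ) 1, ∫⁻ y, G (τ • x + (1 - τ) • y) ^ p ∂ν) ∂ν := by
        simp_rw [lintegral_const_mul' _ _ hLp]
        congr 1
        refine lintegral_congr fun x => lintegral_lintegral_swap (by fun_prop)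
    _ = L ^ p * ∫⁻ τ in Icc (0 : ℝ) 1, ∫⁻ x, ∫⁻ y, G (τ • x + (1 - τ) • y) ^ p ∂ν ∂ν := by
        congr 1
        refine lintegral_lintegral_swap (Measurable.aemeasurable ?_)
        exact Measurable.lintegral_prod_right'
          (f := fun q : (Esp d × ℝ) × Esp d => G (q.1.2 • q.1.1 + (1 - q.1.2) • q.2) ^ p)
          (by fun_prop)
    _ ≤ L ^ p * ∫⁻ τ in Icc (0 : ℝ) 1, M * ν univ := by
        gcongr L ^ p * ?_
        exact setLIntegral_mono' measurableSet_Icc hτ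
    _ = ν univ * (L ^ p * M) := by
        rw [setLIntegral_const, Real.volume_Icc, sub_zero, ENNReal.ofReal_one]; ring

/-- A function is close in weighted `L^p` to its composition with the contraction by `1/2`. -/
theorem lintegral_enorm_sub_comp_contraction_rpow_le (hα : 0 ≤ α) (hr : 0 < r) (hra : r ≤ aa)
    (hp : 1 ≤ p) (hG : Measurable G) (hL : L ≠ ∞)
    (hseg : ∀ x ∈ sball d r (EuclideanSpace.single (0 : Fin d) aa),
      ∀ y ∈ sball d r (EuclideanSpace.single (0 : Fin d) aa),
        ‖f x - f y‖ₑ ≤ L * ∫⁻ τ in Icc (0 : ℝ) 1, G (τ • x + (1 - τ) • y))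
    {c : Esp d} (hc : c ∈ sball d r (EuclideanSpace.single (0 : Fin d) aa)) :
    ∫⁻ x, ‖f x - f ((1 / 2 : ℝ) • x + (1 / 2 : ℝ) • c)‖ₑ ^ p ∂slabMeasure d α r aa ≤
      L ^ p * (ENNReal.ofReal (2 ^ α * 2 ^ d) * ∫⁻ x, G x ^ p ∂slabMeasure d α r aa) := by
  have hfin := isFiniteMeasure_slabMeasure (d := d) hα hr hra
  set ν := slabMeasure d α r aa with hν
  have hLp : L ^ p ≠ ∞ := ENNReal.rpow_ne_top_of_nonneg (by linarith) hL
  set M := ENNReal.ofReal (2 ^ α * 2 ^ d) * ∫⁻ x, G x ^ p ∂ν with hM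
  have hmem := ae_mem_sball d α r aa
  have hcomb : ∀ (τ : ℝ) (x : Esp d), τ • x + (1 - τ) • ((1 / 2 : ℝ) • x + (1 / 2 : ℝ) • c) =
      ((1 + τ) / 2) • x + (1 - (1 + τ) / 2) • c := by
    intro τ x
    module
  calc ∫⁻ x, ‖f x - f ((1 / 2 : ℝ) • x + (1 / 2 : ℝ) • c)‖ₑ ^ p ∂ν
      ≤ ∫⁻ x, L ^ p * (∫⁻ τ in Icc (0 : ℝ) 1,
          G (((1 + τ) / 2) • x + (1 - (1 + τ) / 2) • c) ^ p) ∂ν := by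
        refine lintegral_mono_ae (hmem.mono fun x hx => ?_)
        have hmid := convex_sball _ _ _ hx hc (a := 1 / 2) (b := 1 / 2)
          (by norm_num) (by norm_num) (by norm_num)
        simpa only [hcomb] using enorm_sub_rpow_le_lintegral_segment hp hG hseg hx hmid
    _ = L ^ p * ∫⁻ τ in Icc (0 : ℝ) 1, ∫⁻ x,
          G (((1 + τ) / 2) • x + (1 - (1 + τ) / 2) • c) ^ p ∂ν := by
        rw [lintegral_const_mul' _ _ hLp, lintegral_lintegral_swap (by fun_prop)]
    _ ≤ L ^ p * ∫⁻ τ in Icc (0 : ℝ) 1, M := by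
        gcongr L ^ p * ?_
        refine setLIntegral_mono' measurableSet_Icc fun τ hτ => ?_
        exact lintegral_comp_contraction_le hα hra (hG.pow_const p) (by linarith [hτ.1])
          (by linarith [hτ.2]) hc
    _ = L ^ p * M := by
        rw [setLIntegral_const, Real.volume_Icc, sub_zero, ENNReal.ofReal_one, mul_one]

/-- If `D` is an average of `f` along a segment of contractions, then `D` is close to `f`. -/
theorem lintegral_enorm_sub_segment_average_rpow_le (hα : 0 ≤ α) (hr : 0 < r) (hra : r ≤ aa)
    (hp : 1 ≤ p) (hf : Measurable f) (hG : Measurable G) (hL : L ≠ ∞)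
    (hseg : ∀ x ∈ sball d r (EuclideanSpace.single (0 : Fin d) aa),
      ∀ y ∈ sball d r (EuclideanSpace.single (0 : Fin d) aa),
        ‖f x - f y‖ₑ ≤ L * ∫⁻ τ in Icc (0 : ℝ) 1, G (τ • x + (1 - τ) • y))
    {c : ℝ → Esp d} (hcm : Measurable c)
    (hc : ∀ σ ∈ Icc (0 : ℝ) 1, c σ ∈ sball d r (EuclideanSpace.single (0 : Fin d) aa))
    {D : Esp d → ℝ}
    (hD : ∀ x ∈ sball d r (EuclideanSpace.single (0 : Fin d) aa), ‖f x - D x‖ₑ ≤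
      ∫⁻ σ in Icc (0 : ℝ) 1, ‖f x - f ((1 / 2 : ℝ) • x + (1 / 2 : ℝ) • c σ)‖ₑ) :
    ∫⁻ x, ‖f x - D x‖ₑ ^ p ∂slabMeasure d α r aa ≤
      L ^ p * (ENNReal.ofReal (2 ^ α * 2 ^ d) * ∫⁻ x, G x ^ p ∂slabMeasure d α r aa) := by
  have hfin := isFiniteMeasure_slabMeasure (d := d) hα hr hra
  set ν := slabMeasure d α r aa with hν
  set M := L ^ p * (ENNReal.ofReal (2 ^ α * 2 ^ d) * ∫⁻ x, G x ^ p ∂ν) with hM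
  calc ∫⁻ x, ‖f x - D x‖ₑ ^ p ∂ν
      ≤ ∫⁻ x, (∫⁻ σ in Icc (0 : ℝ) 1,
          ‖f x - f ((1 / 2 : ℝ) • x + (1 / 2 : ℝ) • c σ)‖ₑ ^ p) ∂ν := by
        refine lintegral_mono_ae ((ae_mem_sball d α r aa).mono fun x hx => ?_)
        have hJ := lintegral_rpow_le_measure_univ_rpow_mul
          (ν := volume.restrict (Icc (0 : ℝ) 1)) hp
          (f := fun σ => ‖f x - f ((1 / 2 : ℝ) • x + (1 / 2 : ℝ) • c σ)‖ₑ) (by fun_prop)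
        simp only [Measure.restrict_apply_univ, Real.volume_Icc, sub_zero, ENNReal.ofReal_one,
          ENNReal.one_rpow, one_mul] at hJ
        refine le_trans ?_ hJ
        gcongr
        exact hD x hx
    _ = ∫⁻ σ in Icc (0 : ℝ) 1, ∫⁻ x,
          ‖f x - f ((1 / 2 : ℝ) • x + (1 / 2 : ℝ) • c σ)‖ₑ ^ p ∂ν :=
        lintegral_lintegral_swap (by fun_prop)
    _ ≤ ∫⁻ σ in Icc (0 : ℝ) 1, M :=
        setLIntegral_mono' measurableSet_Icc fun σ hσ =>
          lintegral_enorm_sub_comp_contraction_rpow_le hα hr hra hp hG hL hseg (hc σ hσ)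
    _ = M := by
        rw [setLIntegral_const, Real.volume_Icc, sub_zero, ENNReal.ofReal_one, mul_one]

end Slices

section Smooth

variable {d : ℕ} [NeZero d] {u : ℝ × Esp d → ℝ}

theorem differentiableAt_of_contDiffOn_halfST (hu : ContDiffOn ℝ (⊤ : ℕ∞) u (halfST d))
    {z : ℝ × Esp d} (hz : z ∈ halfST d) : DifferentiableAt ℝ u z :=
  (hu.contDiffAt ((isOpen_halfST d).mem_nhds hz)).differentiableAt (by simp)

theorem psp_eq_fderiv (hu : ContDiffOn ℝ (⊤ : ℕ∞) u (halfST d)) {z : ℝ × Esp d}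
    (hz : z ∈ halfST d) (i : Fin d) :
    psp d i u z = fderiv ℝ u z (0, EuclideanSpace.single i 1) := by
  have h := (differentiableAt_of_contDiffOn_halfST hu hz).hasFDerivAt.comp z.2
    (hasFDerivAt_prodMk_right (𝕜 := ℝ) z.1 z.2)
  have h' : HasFDerivAt (fun y => u (z.1, y))
      ((fderiv ℝ u z).comp (ContinuousLinearMap.inr ℝ ℝ (Esp d))) z.2 := h
  rw [psp, h'.fderiv]
  simp

theorem ptime_eq_fderiv (hu : ContDiffOn ℝ (⊤ : ℕ∞) u (halfST d)) {z : ℝ × Esp d}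
    (hz : z ∈ halfST d) : ptime d u z = fderiv ℝ u z (1, 0) := by
  have h := (differentiableAt_of_contDiffOn_halfST hu hz).hasFDerivAt.comp_hasDerivAt z.1
    ((hasDerivAt_id z.1).prodMk (hasDerivAt_const z.1 z.2))
  exact h.deriv

theorem contDiffOn_fderiv_apply (hu : ContDiffOn ℝ (⊤ : ℕ∞) u (halfST d)) (e : ℝ × Esp d) :
    ContDiffOn ℝ (⊤ : ℕ∞) (fun z => fderiv ℝ u z e) (halfST d) :=
  (hu.fderiv_of_isOpen (isOpen_halfST d) (by simp)).clm_apply contDiffOn_const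

theorem contDiffOn_psp (hu : ContDiffOn ℝ (⊤ : ℕ∞) u (halfST d)) (i : Fin d) :
    ContDiffOn ℝ (⊤ : ℕ∞) (psp d i u) (halfST d) :=
  (contDiffOn_fderiv_apply hu _).congr fun _ hz => psp_eq_fderiv hu hz i

theorem continuousOn_ptime (hu : ContDiffOn ℝ (⊤ : ℕ∞) u (halfST d)) :
    ContinuousOn (ptime d u) (halfST d) :=
  ((contDiffOn_fderiv_apply hu _).congr fun _ hz => ptime_eq_fderiv hu hz).continuousOn

theorem hessNorm_nonneg (u : ℝ × Esp d → ℝ) (z : ℝ × Esp d) : 0 ≤ hessNorm d u z :=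
  Real.sqrt_nonneg _

theorem continuousOn_hessNorm (hu : ContDiffOn ℝ (⊤ : ℕ∞) u (halfST d)) :
    ContinuousOn (hessNorm d u) (halfST d) :=
  Real.continuous_sqrt.comp_continuousOn (continuousOn_finsetSum _ fun i _ =>
    continuousOn_finsetSum _ fun j _ =>
      (contDiffOn_psp (contDiffOn_psp hu j) i).continuousOn.pow 2)

theorem measurable_indicator_halfST {g : ℝ × Esp d → ℝ} (hg : ContinuousOn g (halfST d)) :
    Measurable ((halfST d).indicator g) := by
  classical
  rw [← piecewise_eq_indicator]
  exact hg.measurable_piecewise continuousOn_const (isOpen_halfST d).measurableSet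

theorem fderiv_apply_eq_sum_psp (hu : ContDiffOn ℝ (⊤ : ℕ∞) u (halfST d)) {z : ℝ × Esp d}
    (hz : z ∈ halfST d) (e : Esp d) :
    fderiv ℝ u z (0, e) = ∑ i, e i * psp d i u z := by
  have he : ((0 : ℝ), e) = ∑ i, e i • ((0 : ℝ), EuclideanSpace.single i (1 : ℝ)) := by
    have h := (EuclideanSpace.basisFun (Fin d) ℝ).sum_repr e
    simp only [EuclideanSpace.basisFun_repr, EuclideanSpace.basisFun_apply] at h
    ext1
    · simp [Prod.fst_sum]
    · simp only [Prod.snd_sum, Prod.smul_mk]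
      exact h.symm
  rw [he, map_sum]
  refine Finset.sum_congr rfl fun i _ => ?_
  rw [map_smul, smul_eq_mul, psp_eq_fderiv hu hz]

theorem abs_fderiv_psp_le (hu : ContDiffOn ℝ (⊤ : ℕ∞) u (halfST d)) {z : ℝ × Esp d}
    (hz : z ∈ halfST d) (ℓ : Fin d) (e : Esp d) :
    |fderiv ℝ (psp d ℓ u) z (0, e)| ≤ ‖e‖ * hessNorm d u z := by
  have hle : ∑ i, psp d i (psp d ℓ u) z ^ 2 ≤ ∑ i, ∑ j, psp d i (psp d j u) z ^ 2 :=
    Finset.sum_le_sum fun i _ => Finset.single_le_sum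
      (f := fun j => psp d i (psp d j u) z ^ 2) (fun j _ => sq_nonneg _) (Finset.mem_univ ℓ)
  rw [fderiv_apply_eq_sum_psp (contDiffOn_psp hu ℓ) hz, EuclideanSpace.norm_eq, hessNorm,
    ← Real.sqrt_mul (Finset.sum_nonneg fun i _ => sq_nonneg _)]
  refine Real.abs_le_sqrt ((Finset.sum_mul_sq_le_sq_mul_sq _ _ _).trans ?_)
  simp only [Real.norm_eq_abs, sq_abs]
  gcongr

theorem enorm_sub_le_lintegral_of_hasDerivAt {f f' : ℝ → ℝ} {g : ℝ → ℝ≥0∞} {a b : ℝ}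
    (hab : a ≤ b) (hf : ContDiffOn ℝ 1 f (Icc a b)) (hf' : ∀ τ ∈ Icc a b, HasDerivAt f (f' τ) τ)
    (hg : ∀ τ ∈ Icc a b, ‖f' τ‖ₑ ≤ g τ) : ‖f b - f a‖ₑ ≤ ∫⁻ τ in Icc a b, g τ :=
  (enorm_sub_le_lintegral_deriv_of_contDiffOn_Icc hf hab).trans
    (setLIntegral_mono' measurableSet_Icc fun τ hτ => by
      rw [(hf' τ hτ).deriv]; exact hg τ hτ)

theorem hasDerivAt_comp_affine (hu : ContDiffOn ℝ (⊤ : ℕ∞) u (halfST d)) {t : ℝ} {x e : Esp d}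
    {τ : ℝ} (h : (t, x + τ • e) ∈ halfST d) :
    HasDerivAt (fun τ : ℝ => u (t, x + τ • e)) (fderiv ℝ u (t, x + τ • e) (0, e)) τ := by
  have h1 : HasDerivAt (fun τ : ℝ => x + τ • e) e τ := by
    simpa using ((hasDerivAt_id τ).smul_const e).const_add x
  exact (differentiableAt_of_contDiffOn_halfST hu h).hasFDerivAt.comp_hasDerivAt τ
    ((hasDerivAt_const τ t).prodMk h1)

theorem contDiffOn_comp_affine (hu : ContDiffOn ℝ (⊤ : ℕ∞) u (halfST d)) {t : ℝ} {x e : Esp d}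
    {s : Set ℝ} (h : ∀ τ ∈ s, (t, x + τ • e) ∈ halfST d) :
    ContDiffOn ℝ 1 (fun τ : ℝ => u (t, x + τ • e)) s :=
  (hu.of_le (by simp)).comp (f := fun τ : ℝ => (t, x + τ • e))
    (by fun_prop : ContDiff ℝ 1 fun τ : ℝ => (t, x + τ • e)).contDiffOn h

/-- Variation of a first derivative along a segment of the slab ball. -/
theorem enorm_psp_sub_le (hu : ContDiffOn ℝ (⊤ : ℕ∞) u (halfST d)) {r aa : ℝ} (hr : 0 < r)
    (hra : r ≤ aa) (ℓ : Fin d) (t : ℝ) {x y : Esp d}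
    (hx : x ∈ sball d r (EuclideanSpace.single (0 : Fin d) aa))
    (hy : y ∈ sball d r (EuclideanSpace.single (0 : Fin d) aa)) :
    ‖psp d ℓ u (t, x) - psp d ℓ u (t, y)‖ₑ ≤ ENNReal.ofReal (4 * r) *
      ∫⁻ τ in Icc (0 : ℝ) 1, ‖(halfST d).indicator (hessNorm d u) (t, τ • x + (1 - τ) • y)‖ₑ := by
  have heq : ∀ τ : ℝ, y + τ • (x - y) = τ • x + (1 - τ) • y := fun τ => by module
  have hmem : ∀ τ ∈ Icc (0 : ℝ) 1, (t, y + τ • (x - y)) ∈ halfST d := fun τ hτ => by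
    rw [heq]
    exact pos_of_mem_sball hra
      (convex_sball _ _ _ hx hy hτ.1 (sub_nonneg.2 hτ.2) (add_sub_cancel _ _))
  have hv := contDiffOn_psp hu ℓ
  have h := enorm_sub_le_lintegral_of_hasDerivAt zero_le_one (contDiffOn_comp_affine hv hmem)
    (fun τ hτ => hasDerivAt_comp_affine hv (hmem τ hτ))
    (g := fun τ => ENNReal.ofReal (4 * r) *
      ‖(halfST d).indicator (hessNorm d u) (t, τ • x + (1 - τ) • y)‖ₑ) fun τ hτ => by
        have hm := hmem τ hτ
        rw [← heq, indicator_of_mem hm, ← ofReal_norm, Real.norm_eq_abs,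
          Real.enorm_eq_ofReal (hessNorm_nonneg _ _), ← ENNReal.ofReal_mul (by positivity)]
        refine ENNReal.ofReal_le_ofReal ((abs_fderiv_psp_le hu hm ℓ (x - y)).trans ?_)
        gcongr
        · exact hessNorm_nonneg _ _
        · exact norm_sub_le_of_mem_sball hr hx hy
  rw [lintegral_const_mul' _ _ ENNReal.ofReal_ne_top] at h
  simpa using h

/-- A difference quotient compared with the derivative at another point. -/
theorem enorm_sub_differenceQuotient_le (hu : ContDiffOn ℝ (⊤ : ℕ∞) u (halfST d)) (ℓ : Fin d)
    (t : ℝ) {x : Esp d} {h : ℝ} (hh : h ≠ 0)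
    (hx : ∀ τ ∈ Icc (0 : ℝ) 1, (t, x + τ • (h • EuclideanSpace.single ℓ (1 : ℝ))) ∈ halfST d)
    (c : ℝ) :
    ‖c - h⁻¹ * (u (t, x + h • EuclideanSpace.single ℓ (1 : ℝ)) - u (t, x))‖ₑ ≤
      ∫⁻ τ in Icc (0 : ℝ) 1,
        ‖c - psp d ℓ u (t, x + τ • (h • EuclideanSpace.single ℓ (1 : ℝ)))‖ₑ := by
  set e : Esp d := h • EuclideanSpace.single ℓ (1 : ℝ) with he
  have hsm : ContDiffOn ℝ 1 (fun τ : ℝ => τ * c - h⁻¹ * u (t, x + τ • e)) (Icc 0 1) :=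
    (contDiffOn_id.mul contDiffOn_const).sub
      (contDiffOn_const.mul (contDiffOn_comp_affine hu hx))
  have hder : ∀ τ ∈ Icc (0 : ℝ) 1, HasDerivAt (fun τ : ℝ => τ * c - h⁻¹ * u (t, x + τ • e))
      (c - psp d ℓ u (t, x + τ • e)) τ := fun τ hτ => by
    have h1 := ((hasDerivAt_id τ).mul_const c).sub
      ((hasDerivAt_comp_affine hu (hx τ hτ)).const_mul h⁻¹)
    have h2 : ((0 : ℝ), e) = h • ((0 : ℝ), EuclideanSpace.single ℓ (1 : ℝ)) := by
      simp [he]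
    rw [h2, map_smul, smul_eq_mul, inv_mul_cancel_left₀ hh, ← psp_eq_fderiv hu (hx τ hτ),
      one_mul] at h1
    exact h1
  have h3 := enorm_sub_le_lintegral_of_hasDerivAt zero_le_one hsm hder fun τ _ => le_rfl
  refine (le_of_eq ?_).trans h3
  congr 1
  simp only [one_smul, zero_smul, add_zero]
  ring

theorem enorm_time_sub_le (hu : ContDiffOn ℝ (⊤ : ℕ∞) u (halfST d)) {x : Esp d} (hx : 0 < x 0)
    {a b s t : ℝ} (hs : s ∈ Ioo a b) (ht : t ∈ Ioo a b) :
    ‖u (t, x) - u (s, x)‖ₑ ≤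
      ∫⁻ τ in Ioo a b, ‖(halfST d).indicator (ptime d u) (τ, x)‖ₑ := by
  wlog hst : s ≤ t generalizing s t
  · rw [enorm_sub_rev]
    exact this ht hs (le_of_not_ge hst)
  have hmem : ∀ τ : ℝ, (τ, x) ∈ halfST d := fun _ => hx
  refine (enorm_sub_le_lintegral_of_hasDerivAt (f := fun τ => u (τ, x)) hst
    ((hu.of_le (by simp)).comp (f := fun τ : ℝ => (τ, x))
      (by fun_prop : ContDiff ℝ 1 fun τ : ℝ => (τ, x)).contDiffOn fun τ _ => hmem τ)
    (f' := fun τ => ptime d u (τ, x)) (fun τ _ => ?_)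
    (g := fun τ => ‖(halfST d).indicator (ptime d u) (τ, x)‖ₑ) fun τ _ => ?_).trans
    (lintegral_mono_set (Icc_subset_Ioo hs.1 ht.2))
  · rw [ptime_eq_fderiv hu (hmem τ)]
    exact (differentiableAt_of_contDiffOn_halfST hu (hmem τ)).hasFDerivAt.comp_hasDerivAt τ
      ((hasDerivAt_id τ).prodMk (hasDerivAt_const τ x))
  · rw [indicator_of_mem (hmem τ)]

end Smooth

/-- Time oscillation of a scaled spatial difference of `u`, in weighted `L^p`. -/
theorem lintegral_enorm_time_sub_rpow_le {d : ℕ} [NeZero d] {α r aa p : ℝ} (hα : 0 ≤ α)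
    (hr : 0 < r) (hra : r ≤ aa) (hp : 1 ≤ p) {u : ℝ × Esp d → ℝ}
    (hu : ContDiffOn ℝ (⊤ : ℕ∞) u (halfST d)) {c₀ c₁ : Esp d}
    (hc₀ : c₀ ∈ sball d r (EuclideanSpace.single (0 : Fin d) aa))
    (hc₁ : c₁ ∈ sball d r (EuclideanSpace.single (0 : Fin d) aa)) (k : ℝ) {a b s t : ℝ}
    (hs : s ∈ Ioo a b) (ht : t ∈ Ioo a b) :
    ∫⁻ y, ‖k * (u (t, (1 / 2 : ℝ) • y + (1 / 2 : ℝ) • c₁)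
          - u (t, (1 / 2 : ℝ) • y + (1 / 2 : ℝ) • c₀))
        - k * (u (s, (1 / 2 : ℝ) • y + (1 / 2 : ℝ) • c₁)
          - u (s, (1 / 2 : ℝ) • y + (1 / 2 : ℝ) • c₀))‖ₑ ^ p ∂slabMeasure d α r aa ≤
      ‖k‖ₑ ^ p * (2 ^ p * (ENNReal.ofReal (b - a) ^ (p - 1) *
        (2 * (ENNReal.ofReal (2 ^ α * 2 ^ d) * ∫⁻ τ in Ioo a b,
          ∫⁻ y, ‖(halfST d).indicator (ptime d u) (τ, y)‖ₑ ^ p ∂slabMeasure d α r aa)))) := by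
  have hfin := isFiniteMeasure_slabMeasure (d := d) hα hr hra
  set ν := slabMeasure d α r aa with hν
  have hp0 : 0 ≤ p := by linarith
  have hTm := measurable_indicator_halfST (continuousOn_ptime hu)
  set T : ℝ × Esp d → ℝ := (halfST d).indicator (ptime d u) with hT
  set B := sball d r (EuclideanSpace.single (0 : Fin d) aa) with hB
  have hpt : ∀ c ∈ B, ∀ y ∈ B,
      ‖u (t, (1 / 2 : ℝ) • y + (1 / 2 : ℝ) • c) - u (s, (1 / 2 : ℝ) • y + (1 / 2 : ℝ) • c)‖ₑ ^ p ≤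
        ENNReal.ofReal (b - a) ^ (p - 1) *
          ∫⁻ τ in Ioo a b, ‖T (τ, (1 / 2 : ℝ) • y + (1 / 2 : ℝ) • c)‖ₑ ^ p := by
    intro c hc y hy
    have hmid := convex_sball _ _ _ hy hc (a := 1 / 2) (b := 1 / 2)
      (by norm_num) (by norm_num) (by norm_num)
    have hJ := lintegral_rpow_le_measure_univ_rpow_mul (ν := volume.restrict (Ioo a b)) hp
      (f := fun τ => ‖T (τ, (1 / 2 : ℝ) • y + (1 / 2 : ℝ) • c)‖ₑ) (by fun_prop)
    simp only [Measure.restrict_apply_univ, Real.volume_Ioo] at hJ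
    refine le_trans ?_ hJ
    gcongr
    exact enorm_time_sub_le hu (pos_of_mem_sball hra hmid) hs ht
  have hint : ∀ c ∈ B,
      ∫⁻ y, (∫⁻ τ in Ioo a b, ‖T (τ, (1 / 2 : ℝ) • y + (1 / 2 : ℝ) • c)‖ₑ ^ p) ∂ν ≤
        ENNReal.ofReal (2 ^ α * 2 ^ d) * ∫⁻ τ in Ioo a b, ∫⁻ y, ‖T (τ, y)‖ₑ ^ p ∂ν := by
    intro c hc
    rw [lintegral_lintegral_swap (by fun_prop), ← lintegral_const_mul' _ _ ENNReal.ofReal_ne_top]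
    refine lintegral_mono fun τ => ?_
    have := lintegral_comp_contraction_le hα hra (g := fun y => ‖T (τ, y)‖ₑ ^ p) (by fun_prop)
      (τ := 1 / 2) le_rfl (by norm_num) hc
    norm_num at this ⊢
    exact this
  have hE : ∀ c : Esp d, Measurable fun y =>
      ∫⁻ τ in Ioo a b, ‖T (τ, (1 / 2 : ℝ) • y + (1 / 2 : ℝ) • c)‖ₑ ^ p := fun c =>
    Measurable.lintegral_prod_right'
      (f := fun q : Esp d × ℝ => ‖T (q.2, (1 / 2 : ℝ) • q.1 + (1 / 2 : ℝ) • c)‖ₑ ^ p)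
      (by fun_prop)
  have hR : ENNReal.ofReal (b - a) ^ (p - 1) ≠ ∞ :=
    ENNReal.rpow_ne_top_of_nonneg (by linarith) ENNReal.ofReal_ne_top
  have h2 : (2 : ℝ≥0∞) ^ p ≠ ∞ := ENNReal.rpow_ne_top_of_nonneg hp0 ENNReal.ofNat_ne_top
  have hk : ‖k‖ₑ ^ p ≠ ∞ := ENNReal.rpow_ne_top_of_nonneg hp0 enorm_ne_top
  have hbound := lintegral_mono_ae (μ := ν) ((ae_mem_sball d α r aa).mono fun y hy => by
    set m₀ := (1 / 2 : ℝ) • y + (1 / 2 : ℝ) • c₀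
    set m₁ := (1 / 2 : ℝ) • y + (1 / 2 : ℝ) • c₁
    calc ‖k * (u (t, m₁) - u (t, m₀)) - k * (u (s, m₁) - u (s, m₀))‖ₑ ^ p
        = ‖k‖ₑ ^ p * ‖(u (t, m₁) - u (s, m₁)) - (u (t, m₀) - u (s, m₀))‖ₑ ^ p := by
          rw [← ENNReal.mul_rpow_of_nonneg _ _ hp0, ← enorm_mul]
          congr 2
          ring
      _ ≤ ‖k‖ₑ ^ p * (‖u (t, m₁) - u (s, m₁)‖ₑ + ‖u (t, m₀) - u (s, m₀)‖ₑ) ^ p := by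
          gcongr
          exact enorm_sub_le
      _ ≤ ‖k‖ₑ ^ p * (2 ^ p * (‖u (t, m₁) - u (s, m₁)‖ₑ ^ p
            + ‖u (t, m₀) - u (s, m₀)‖ₑ ^ p)) := by
          gcongr
          refine (ENNReal.rpow_add_le_mul_rpow_add_rpow _ _ hp).trans ?_
          gcongr
          · exact one_le_two
          · linarith
      _ ≤ ‖k‖ₑ ^ p * (2 ^ p * (ENNReal.ofReal (b - a) ^ (p - 1) *
            ((∫⁻ τ in Ioo a b, ‖T (τ, m₁)‖ₑ ^ p) + ∫⁻ τ in Ioo a b, ‖T (τ, m₀)‖ₑ ^ p))) := by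
          rw [mul_add (ENNReal.ofReal (b - a) ^ (p - 1))]
          gcongr
          · exact hpt c₁ hc₁ y hy
          · exact hpt c₀ hc₀ y hy)
  refine hbound.trans ?_
  rw [lintegral_const_mul' _ _ hk, lintegral_const_mul' _ _ h2, lintegral_const_mul' _ _ hR,
    lintegral_add_left (hE c₁), two_mul]
  gcongr
  · exact hint c₁ hc₁
  · exact hint c₀ hc₀

theorem ofReal_sq_mul_rpow_eq {r p : ℝ} (hr : 0 < r) (hp : 1 ≤ p) :
    ENNReal.ofReal (r ^ 2) * (‖(r / 4)⁻¹‖ₑ ^ p * (2 ^ p * ENNReal.ofReal (r ^ 2) ^ (p - 1))) =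
      ENNReal.ofReal (8 ^ p * r ^ p) := by
  have hp0 : 0 ≤ p := by linarith
  have h2 : (2 : ℝ≥0∞) = ENNReal.ofReal 2 := by simp
  rw [Real.enorm_eq_ofReal (by positivity), h2, ENNReal.ofReal_rpow_of_nonneg (by positivity) hp0,
    ENNReal.ofReal_rpow_of_nonneg (by positivity) hp0,
    ENNReal.ofReal_rpow_of_nonneg (by positivity) (by linarith),
    ← ENNReal.ofReal_mul (by positivity), ← ENNReal.ofReal_mul (by positivity),
    ← ENNReal.ofReal_mul (by positivity)]
  congr 1
  have h1 : r ^ 2 * (r ^ 2) ^ (p - 1) = (r ^ 2) ^ p := by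
    rw [Real.rpow_sub_one (by positivity)]
    field_simp
  calc r ^ 2 * ((r / 4)⁻¹ ^ p * (2 ^ p * (r ^ 2) ^ (p - 1)))
      = (r / 4)⁻¹ ^ p * 2 ^ p * (r ^ 2 * (r ^ 2) ^ (p - 1)) := by ring
    _ = ((r / 4)⁻¹ * 2 * r ^ 2) ^ p := by
      rw [h1, Real.mul_rpow (by positivity) (by positivity),
        Real.mul_rpow (by positivity) (by positivity)]
    _ = (8 * r) ^ p := by
      congr 1
      field_simp
      norm_num
    _ = 8 ^ p * r ^ p := Real.mul_rpow (by positivity) hr.le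

/-- The oscillation estimate for first derivatives with an explicit constant. -/
theorem lintegral_psp_sub_average_rpow_le {d : ℕ} [NeZero d] {α r aa p : ℝ} (hp : 1 ≤ p)
    (hα : 0 ≤ α) (hr : 0 < r) (hra : r ≤ aa) {u : ℝ × Esp d → ℝ}
    (hu : ContDiffOn ℝ (⊤ : ℕ∞) u (halfST d)) (ℓ : Fin d) :
    ∫⁻ z in cylA d r aa,
        ENNReal.ofReal (|psp d ℓ u z - avgR (muW d α) (cylA d r aa) (psp d ℓ u)| ^ p)
        ∂(muW d α) ≤
      ENNReal.ofReal (3 * 32 ^ p * (2 ^ α * 2 ^ d) * r ^ p) *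
        ∫⁻ z in cylA d r aa, ENNReal.ofReal (hessNorm d u z ^ p + |ptime d u z| ^ p)
          ∂(muW d α) := by
  have hp0 : 0 ≤ p := by linarith
  have hofReal : ∀ x : ℝ, ENNReal.ofReal (|x| ^ p) = ‖x‖ₑ ^ p := fun x => by
    rw [← ENNReal.ofReal_rpow_of_nonneg (abs_nonneg x) hp0, ← Real.norm_eq_abs, ofReal_norm]
  have hfin := isFiniteMeasure_slabMeasure (d := d) hα hr hra
  set v := (halfST d).indicator (psp d ℓ u) with hv
  set U := (halfST d).indicator u with hU
  set G := (halfST d).indicator (hessNorm d u) with hG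
  set T := (halfST d).indicator (ptime d u) with hT
  have hvm : Measurable v := measurable_indicator_halfST (contDiffOn_psp hu ℓ).continuousOn
  have hUm : Measurable U := measurable_indicator_halfST hu.continuousOn
  have hGm : Measurable G := measurable_indicator_halfST (continuousOn_hessNorm hu)
  have hTm : Measurable T := measurable_indicator_halfST (continuousOn_ptime hu)
  set b : Esp d := EuclideanSpace.single (0 : Fin d) aa with hb
  set e : Esp d := EuclideanSpace.single ℓ (1 : ℝ) with he
  set B := sball d r b with hB
  have hBhalf : ∀ t : ℝ, ∀ x ∈ B, (t, x) ∈ halfST d := fun _ x hx => pos_of_mem_sball hra hx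
  set κ := (volume : Measure ℝ).restrict (Ioo 0 (r ^ 2)) with hκ
  set ν := slabMeasure d α r aa with hν
  set C := ENNReal.ofReal (2 ^ α * 2 ^ d) with hC
  have hκuniv : κ univ = ENNReal.ofReal (r ^ 2) := by simp [hκ]
  set c : ℝ → Esp d := fun σ => b + (σ * (r / 2)) • e with hc
  have hcB : ∀ σ ∈ Icc (0 : ℝ) 1, c σ ∈ B := fun σ hσ => by
    refine add_smul_single_mem_sball ?_ ℓ
    rw [abs_of_nonneg (mul_nonneg hσ.1 (by positivity))]
    nlinarith [hσ.2]
  have hmid : ∀ y ∈ B, ∀ σ ∈ Icc (0 : ℝ) 1, (1 / 2 : ℝ) • y + (1 / 2 : ℝ) • c σ ∈ B :=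
    fun y hy σ hσ => convex_sball _ _ _ hy (hcB σ hσ) (by norm_num) (by norm_num) (by norm_num)
  have h0 : (0 : ℝ) ∈ Icc (0 : ℝ) 1 := left_mem_Icc.2 zero_le_one
  have h1 : (1 : ℝ) ∈ Icc (0 : ℝ) 1 := right_mem_Icc.2 zero_le_one
  -- the comparison function: a difference quotient of `u` at a contracted point
  set D : ℝ × Esp d → ℝ := fun z => (r / 4)⁻¹ *
    (U (z.1, (1 / 2 : ℝ) • z.2 + (1 / 2 : ℝ) • c 1)
      - U (z.1, (1 / 2 : ℝ) • z.2 + (1 / 2 : ℝ) • c 0)) with hD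
  have hDm : Measurable D := by fun_prop
  have hDu : ∀ t : ℝ, ∀ y ∈ B, D (t, y) = (r / 4)⁻¹ *
      (u (t, (1 / 2 : ℝ) • y + (1 / 2 : ℝ) • c 1)
        - u (t, (1 / 2 : ℝ) • y + (1 / 2 : ℝ) • c 0)) := fun t y hy => by
    simp only [hD, hU]
    rw [indicator_of_mem (hBhalf t _ (hmid y hy 1 h1)),
      indicator_of_mem (hBhalf t _ (hmid y hy 0 h0))]
  have hvu : ∀ t : ℝ, ∀ y ∈ B, v (t, y) = psp d ℓ u (t, y) := fun t y hy =>
    indicator_of_mem (hBhalf t y hy) _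
  have hseg : ∀ t : ℝ, ∀ x ∈ B, ∀ y ∈ B, ‖v (t, x) - v (t, y)‖ₑ ≤ ENNReal.ofReal (4 * r) *
      ∫⁻ τ in Icc (0 : ℝ) 1, ‖G (t, τ • x + (1 - τ) • y)‖ₑ := fun t x hx y hy => by
    rw [hvu t x hx, hvu t y hy]
    exact enorm_psp_sub_le hu hr hra ℓ t hx hy
  have hDdist : ∀ t : ℝ, ∀ y ∈ B, ‖v (t, y) - D (t, y)‖ₑ ≤ ∫⁻ σ in Icc (0 : ℝ) 1,
      ‖v (t, y) - v (t, (1 / 2 : ℝ) • y + (1 / 2 : ℝ) • c σ)‖ₑ := fun t y hy => by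
    have hshift : ∀ σ : ℝ, (1 / 2 : ℝ) • y + (1 / 2 : ℝ) • c σ =
        ((1 / 2 : ℝ) • y + (1 / 2 : ℝ) • c 0) + σ • ((r / 4) • e) := fun σ => by
      simp only [hc]
      module
    have hmem : ∀ σ ∈ Icc (0 : ℝ) 1,
        (t, ((1 / 2 : ℝ) • y + (1 / 2 : ℝ) • c 0) + σ • ((r / 4) • e)) ∈ halfST d :=
      fun σ hσ => by
        rw [← hshift]
        exact hBhalf t _ (hmid y hy σ hσ)
    have h := enorm_sub_differenceQuotient_le hu ℓ t (h := r / 4) (by positivity) hmem (v (t, y))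
    rw [hDu t y hy, hshift 1, one_smul]
    refine h.trans (setLIntegral_mono' measurableSet_Icc fun σ hσ => ?_)
    rw [hshift σ, hv, indicator_of_mem (hmem σ hσ)]
  set IG := ∫⁻ z, ‖G z‖ₑ ^ p ∂(κ.prod ν) with hIG
  set IT := ∫⁻ z, ‖T z‖ₑ ^ p ∂(κ.prod ν) with hIT
  have hIG' : ∫⁻ t, ∫⁻ x, ‖G (t, x)‖ₑ ^ p ∂ν ∂κ = IG :=
    (lintegral_prod (fun z => ‖G z‖ₑ ^ p) (by fun_prop)).symm
  have hIT' : ∫⁻ t, ∫⁻ x, ‖T (t, x)‖ₑ ^ p ∂ν ∂κ = IT :=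
    (lintegral_prod (fun z => ‖T z‖ₑ ^ p) (by fun_prop)).symm
  have hLtop : ENNReal.ofReal (4 * r) ^ p ≠ ∞ :=
    ENNReal.rpow_ne_top_of_nonneg hp0 ENNReal.ofReal_ne_top
  have hdouble : ∫⁻ z, ∫⁻ z', ‖v z - v z'‖ₑ ^ p ∂(κ.prod ν) ∂(κ.prod ν) ≤
      4 ^ p * (κ univ * ν univ) * (3 * (ENNReal.ofReal (4 * r) ^ p * (C * IG)) + κ univ *
        (‖(r / 4)⁻¹‖ₑ ^ p * (2 ^ p * (ENNReal.ofReal (r ^ 2) ^ (p - 1) * (2 * (C * IT)))))) := by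
    have h := lintegral_lintegral_enorm_sub_rpow_le (κ := κ) (ν := ν) hp hvm hDm
      (H := fun t => ENNReal.ofReal (4 * r) ^ p * (C * ∫⁻ x, ‖G (t, x)‖ₑ ^ p ∂ν))
      (T := ‖(r / 4)⁻¹‖ₑ ^ p * (2 ^ p * (ENNReal.ofReal (r ^ 2) ^ (p - 1) * (2 * (C * IT)))))
      (Filter.Eventually.of_forall fun t =>
        lintegral_lintegral_enorm_sub_rpow_le_slab (f := fun x => v (t, x))
          (G := fun x => ‖G (t, x)‖ₑ) hα hr hra hp (by fun_prop) ENNReal.ofReal_ne_top (hseg t))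
      (Filter.Eventually.of_forall fun t =>
        lintegral_enorm_sub_segment_average_rpow_le (f := fun x => v (t, x))
          (D := fun x => D (t, x)) (G := fun x => ‖G (t, x)‖ₑ) hα hr hra hp (by fun_prop)
          (by fun_prop) ENNReal.ofReal_ne_top (hseg t) (c := c) (by fun_prop) hcB (hDdist t))
      ((ae_restrict_mem measurableSet_Ioo).mono fun t ht =>
        (ae_restrict_mem measurableSet_Ioo).mono fun s hs => by
          have h := lintegral_enorm_time_sub_rpow_le hα hr hra hp hu (hcB 0 h0) (hcB 1 h1)
            (r / 4)⁻¹ hs ht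
          rw [sub_zero, hIT'] at h
          refine (lintegral_mono_ae ((ae_mem_sball d α r aa).mono fun y hy => ?_)).trans h
          rw [hDu t y hy, hDu s y hy])
    rwa [lintegral_const_mul' _ _ hLtop, lintegral_const_mul' _ _ ENNReal.ofReal_ne_top,
      hIG'] at h
  have hP : (κ.prod ν) univ = κ univ * ν univ := by
    rw [← univ_prod_univ, Measure.prod_prod]
  have hP0 : (κ.prod ν) univ ≠ 0 := by
    rw [hP, hκuniv]
    exact mul_ne_zero (by simpa using hr.ne') (slabMeasure_univ_ne_zero hr hra)
  have hPtop : (κ.prod ν) univ ≠ ∞ := measure_ne_top _ _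
  have hmeasQ : MeasurableSet (cylA d r aa) :=
    measurableSet_Ioo.prod (isOpen_sball _ _ _).measurableSet
  have hQ : (muW d α).restrict (cylA d r aa) = κ.prod ν := muW_restrict_cylA hra
  have haeQ : ∀ᵐ z ∂(κ.prod ν), z ∈ halfST d := by
    rw [← hQ]
    exact (ae_restrict_mem hmeasQ).mono fun z hz => hBhalf z.1 z.2 hz.2
  have havg : avgR (muW d α) (cylA d r aa) (psp d ℓ u) =
      ((κ.prod ν) univ).toReal⁻¹ * ∫ z, v z ∂(κ.prod ν) := by
    rw [avgR, hQ, ← hQ, Measure.restrict_apply_univ, hQ]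
    congr 1
    exact integral_congr_ae (haeQ.mono fun z hz => (indicator_of_mem hz _).symm)
  have hrhs : ∫⁻ z, ENNReal.ofReal (hessNorm d u z ^ p + |ptime d u z| ^ p) ∂(κ.prod ν) =
      IG + IT := by
    rw [hIG, hIT, ← lintegral_add_left (by fun_prop)]
    refine lintegral_congr_ae (haeQ.mono fun z hz => ?_)
    have hn := hessNorm_nonneg u z
    simp only [hG, hT]
    rw [indicator_of_mem hz, indicator_of_mem hz, ENNReal.ofReal_add (by positivity)
      (by positivity), hofReal, ← hofReal (hessNorm d u z), abs_of_nonneg hn]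
  have hfour : (4 : ℝ≥0∞) ^ p = ENNReal.ofReal (4 ^ p) := by
    rw [← ENNReal.ofReal_rpow_of_nonneg (by norm_num) hp0]
    simp
  rw [hQ, hrhs]
  calc ∫⁻ z, ENNReal.ofReal (|psp d ℓ u z - avgR (muW d α) (cylA d r aa) (psp d ℓ u)| ^ p)
        ∂(κ.prod ν)
      ≤ ∫⁻ z, ((κ.prod ν) univ)⁻¹ * ∫⁻ z', ‖v z - v z'‖ₑ ^ p ∂(κ.prod ν) ∂(κ.prod ν) := by
        refine lintegral_mono_ae (haeQ.mono fun z hz => ?_)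
        have h := enorm_sub_average_rpow_le hP0 hp hvm (v z)
        rw [hofReal, havg]
        refine le_trans (le_of_eq ?_) h
        rw [hv, indicator_of_mem hz]
    _ = ((κ.prod ν) univ)⁻¹ * ∫⁻ z, ∫⁻ z', ‖v z - v z'‖ₑ ^ p ∂(κ.prod ν) ∂(κ.prod ν) :=
        lintegral_const_mul' _ _ (ENNReal.inv_ne_top.2 hP0)
    _ ≤ ((κ.prod ν) univ)⁻¹ * (4 ^ p * (κ univ * ν univ) *
          (3 * (ENNReal.ofReal (4 * r) ^ p * (C * IG)) + κ univ * (‖(r / 4)⁻¹‖ₑ ^ p *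
            (2 ^ p * (ENNReal.ofReal (r ^ 2) ^ (p - 1) * (2 * (C * IT))))))) := by
        gcongr
    _ = 4 ^ p * C * (3 * ENNReal.ofReal (4 * r) ^ p * IG + 2 * (ENNReal.ofReal (r ^ 2) *
          (‖(r / 4)⁻¹‖ₑ ^ p * (2 ^ p * ENNReal.ofReal (r ^ 2) ^ (p - 1)))) * IT) := by
        rw [← hP, hκuniv]
        calc _ = (((κ.prod ν) univ)⁻¹ * (κ.prod ν) univ) * (4 ^ p * C *
              (3 * ENNReal.ofReal (4 * r) ^ p * IG + 2 * (ENNReal.ofReal (r ^ 2) *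
                (‖(r / 4)⁻¹‖ₑ ^ p * (2 ^ p * ENNReal.ofReal (r ^ 2) ^ (p - 1)))) * IT)) := by ring
          _ = _ := by rw [ENNReal.inv_mul_cancel hP0 hPtop, one_mul]
    _ ≤ 4 ^ p * C * (3 * ENNReal.ofReal (8 ^ p * r ^ p) * IG
          + 3 * ENNReal.ofReal (8 ^ p * r ^ p) * IT) := by
        rw [ofReal_sq_mul_rpow_eq hr hp]
        gcongr
        · rw [ENNReal.ofReal_rpow_of_nonneg (by positivity) hp0,
            Real.mul_rpow (by norm_num) hr.le]
          gcongr
          norm_num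
        · norm_num
    _ = ENNReal.ofReal (3 * 32 ^ p * (2 ^ α * 2 ^ d) * r ^ p) * (IG + IT) := by
        have h3 : (3 : ℝ≥0∞) = ENNReal.ofReal 3 := by simp
        have h32 : (32 : ℝ) ^ p = 4 ^ p * 8 ^ p := by
          rw [← Real.mul_rpow (by norm_num) (by norm_num)]; norm_num
        rw [← mul_add, hfour, h3, hC, ← mul_assoc, ← ENNReal.ofReal_mul (by positivity),
          ← ENNReal.ofReal_mul (by positivity), ← ENNReal.ofReal_mul (by positivity), h32]
        congr 2
        ring

/-- **Oscillation estimate for first derivatives.** -/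
theorem stmt5 (d : ℕ) [NeZero d] (p θ δ K : ℝ)
    (hp : 1 ≤ p) (hθ₁ : (d : ℝ) - 1 < θ) (hθ₂ : θ < (d : ℝ) - 1 + p)
    (hδ : 0 < δ) (hδK : δ ≤ K) :
    ∃ N : ℝ, 0 < N ∧
      ∀ A : ℝ → Fin d → Fin d → ℝ, (∀ i j, Measurable fun t => A t i j) →
        ellipT d A δ K →
      ∀ aa r : ℝ, 0 < r → r ≤ aa →
      ∀ u : ℝ × Esp d → ℝ, ContDiffOn ℝ (⊤ : ℕ∞) u (halfST d) →
      ∀ ℓ : Fin d,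
        (∫⁻ z in cylA d r aa,
            ENNReal.ofReal
              (|psp d ℓ u z - avgR (muW d (θ - d + p)) (cylA d r aa) (psp d ℓ u)| ^ p)
            ∂(muW d (θ - d + p))) ≤
          ENNReal.ofReal (N * r ^ p) *
            ∫⁻ z in cylA d r aa,
              ENNReal.ofReal (hessNorm d u z ^ p + |ptime d u z| ^ p)
              ∂(muW d (θ - d + p)) := by
  have hα : 0 ≤ θ - d + p := by linarith
  set α : ℝ := θ - d + p
  refine ⟨3 * 32 ^ p * (2 ^ α * 2 ^ d), by positivity, ?_⟩
  intro _ _ _ aa r hr hra u hu ℓ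
  exact lintegral_psp_sub_average_rpow_le hp hα hr hra hu ℓ
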